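/- arXiv:0808.2165 — 7 statements merged into one kernel-verified Lean document; each statement's English description precedes it below -/
import Mathlib

section
/- Let L be a real d×d matrix with symmetric part S = (1/2)(L + Lᵀ) and antisymmetric part A = (1/2)(L − Lᵀ), and let F ∈ ℝ. Then L satisfies the optical constraint L Lᵀ = F S if and only if S A = A S and A² = S² − F S (the basis-independent form of the generalized Goldberg-Sachs condition). -/
open Matrix

/-- If `L * M` is a nonzero multiple of `L + M`, then `L` and `M` commute: the matrices
`c⁻¹ • L - 1` and `c⁻¹ • M - 1` are inverse to each other. -/
theorem Matrix.mul_comm_of_mul_eq_smul_add {n K : Type*} [Fintype n] [DecidableEq n] [Field K]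
    {L M : Matrix n n K} {c : K} (hc : c ≠ 0) (h : L * M = c • (L + M)) :
    M * L = L * M := by
  have expand (X Y : Matrix n n K) :
      (c⁻¹ • X - 1) * (c⁻¹ • Y - 1) = (c⁻¹ * c⁻¹) • (X * Y) - c⁻¹ • (X + Y) + 1 := by
    simp only [sub_mul, mul_sub, smul_mul_assoc, mul_smul_comm, mul_one, one_mul]
    module
  have hinv : (c⁻¹ • L - 1) * (c⁻¹ • M - 1) = 1 := by
    rw [expand, h, smul_smul, mul_assoc, inv_mul_cancel₀ hc, mul_one, sub_self, zero_add]
  have hinv' := mul_eq_one_comm.mp hinv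
  have heq := hinv.trans hinv'.symm
  rw [expand, expand, add_comm M L] at heq
  have hsmul := sub_left_injective (add_left_injective _ heq)
  exact (smul_right_injective _ (mul_ne_zero (inv_ne_zero hc) (inv_ne_zero hc)) hsmul).symm

/-- A real matrix satisfying the optical constraint is normal. -/
theorem transpose_mul_self_of_opticalConstraint {n : Type*} [Fintype n] [DecidableEq n]
    {L : Matrix n n ℝ} {F : ℝ} (h : L * Lᵀ = F • ((1 / 2 : ℝ) • (L + Lᵀ))) :
    Lᵀ * L = L * Lᵀ := by
  obtain rfl | hF := eq_or_ne F 0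
  · rw [zero_smul, ← conjTranspose_eq_transpose_of_trivial,
      self_mul_conjTranspose_eq_zero] at h
    simp [h]
  · rw [smul_smul] at h
    exact mul_comm_of_mul_eq_smul_add (mul_ne_zero hF (by norm_num)) h

/-- The optical constraint `L Lᵀ = F S` holds if and only if the symmetric part
`S = (1/2)(L + Lᵀ)` and antisymmetric part `A = (1/2)(L − Lᵀ)` satisfy
`S A = A S` and `A² = S² − F S` (the basis-independent generalized
Goldberg-Sachs condition). -/
theorem opticalConstraint_iff_goldbergSachs {d : ℕ} (L : Matrix (Fin d) (Fin d) ℝ) (F : ℝ) :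
    L * Lᵀ = F • ((1 / 2 : ℝ) • (L + Lᵀ)) ↔
      (((1 / 2 : ℝ) • (L + Lᵀ)) * ((1 / 2 : ℝ) • (L - Lᵀ)) =
        ((1 / 2 : ℝ) • (L - Lᵀ)) * ((1 / 2 : ℝ) • (L + Lᵀ)) ∧
      ((1 / 2 : ℝ) • (L - Lᵀ)) * ((1 / 2 : ℝ) • (L - Lᵀ)) =
        ((1 / 2 : ℝ) • (L + Lᵀ)) * ((1 / 2 : ℝ) • (L + Lᵀ)) -
          F • ((1 / 2 : ℝ) • (L + Lᵀ))) := by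
  constructor
  · intro h
    have hn := transpose_mul_self_of_opticalConstraint h
    rw [← h]
    simp only [smul_mul_assoc, mul_smul_comm, add_mul, mul_add, sub_mul, mul_sub, hn]
    exact ⟨by module, by module⟩
  · rintro ⟨hcomm, hsq⟩
    have hS : F • ((1 / 2 : ℝ) • (L + Lᵀ)) =
        ((1 / 2 : ℝ) • (L + Lᵀ)) * ((1 / 2 : ℝ) • (L + Lᵀ)) -
          ((1 / 2 : ℝ) • (L - Lᵀ)) * ((1 / 2 : ℝ) • (L - Lᵀ)) := by
      rw [hsq, sub_sub_cancel]
    rw [hS]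
    simp only [smul_mul_assoc, mul_smul_comm, add_mul, mul_add, sub_mul, mul_sub] at hcomm ⊢
    linear_combination (norm := module) (-1 : ℝ) • hcomm
end

section
/- Let d ≥ 1, let L be an invertible real d×d matrix, and let F ∈ ℝ be such that L satisfies the optical constraint L Lᵀ = F S with S = (1/2)(L + Lᵀ). Then F ≠ 0 and the symmetric part of L⁻¹ is the scalar matrix F⁻¹·1, i.e. L⁻¹ + (L⁻¹)ᵀ = (2/F)·1. -/
open Matrix

/-- If `d ≥ 1` and an invertible real `d×d` matrix `L` satisfies the optical
constraint `L Lᵀ = F S` with `S = (1/2)(L + Lᵀ)`, then `F ≠ 0` and the symmetric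
part of `L⁻¹` is the scalar matrix `F⁻¹·1`, i.e. `L⁻¹ + (L⁻¹)ᵀ = (2/F)·1`. -/
theorem opticalConstraint_inv_symmPart {d : ℕ} (hd : 1 ≤ d)
    (L : Matrix (Fin d) (Fin d) ℝ) (F : ℝ)
    (hL : IsUnit L.det)
    (h : L * Lᵀ = F • ((1 / 2 : ℝ) • (L + Lᵀ))) :
    F ≠ 0 ∧ L⁻¹ + (L⁻¹)ᵀ = (2 / F) • (1 : Matrix (Fin d) (Fin d) ℝ) := by
  have hLt : IsUnit Lᵀ.det := by rwa [det_transpose]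
  have key : (1 : Matrix (Fin d) (Fin d) ℝ) = F • ((1 / 2 : ℝ) • (L⁻¹ + (L⁻¹)ᵀ)) := by
    have hconj := congrArg (fun M => L⁻¹ * M * Lᵀ⁻¹) h
    simp only [Matrix.mul_smul, Matrix.smul_mul, mul_add, add_mul,
      nonsing_inv_mul_cancel_left _ _ hL, nonsing_inv_mul _ hL,
      mul_nonsing_inv_cancel_right _ _ hLt, mul_nonsing_inv _ hLt, one_mul] at hconj
    rw [hconj, transpose_nonsing_inv, add_comm]
  have hF : F ≠ 0 := by
    rintro rfl
    have : Nonempty (Fin d) := ⟨⟨0, hd⟩⟩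
    rw [zero_smul] at key
    exact one_ne_zero key
  refine ⟨hF, ?_⟩
  have hc : 2 / F * (F * (1 / 2)) = 1 := by field_simp
  rw [key, smul_smul, smul_smul, mul_assoc, hc, one_smul]
end

section
/- Let L be a real d×d matrix satisfying the optical constraint L Lᵀ = F S for some F ∈ ℝ, with S = (1/2)(L + Lᵀ). Then there exist a natural number p with 2p ≤ d, an orthogonal d×d matrix Q, a bijection e : (Fin p × Fin 2) ⊕ Fin (d − 2p) ≃ Fin d, real numbers s₁,…,s_p and a₁,…,a_p with a_μ ≠ 0 and a_μ² = s_μ(F − s_μ) for every μ, and a vector δ ∈ ℝ^{d−2p} each of whose entries equals F or 0, such that Qᵀ L Q equals (under the re-indexing e) the block-diagonal matrix whose μ-th 2×2 diagonal block is [[s_μ, a_μ], [−a_μ, s_μ]] for μ = 1,…,p, and whose remaining block is the diagonal matrix with diagonal entries δ. -/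
open Matrix

open scoped InnerProductSpace

section Frame

variable {E : Type*} [NormedAddCommGroup E] [InnerProductSpace ℝ E]

/-- An orthonormal family adapted to a symmetric map `S` and an antisymmetric map `A`: the vectors
indexed by `κ` are eigenvectors of `S`, with eigenvalue `F` or `0`, which are killed by `A`, while
those indexed by `ι × Fin 2` come in pairs spanning planes on which `S` is a scalar and `A` is a
nonzero multiple of a quarter turn. -/
structure OpticalFrame (S A : E →ₗ[ℝ] E) (F : ℝ) (ι κ : Type) where
  /-- The vectors of the family. -/
  vec : (ι × Fin 2) ⊕ κ → E
  /-- The eigenvalue of `S` on each plane. -/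
  s : ι → ℝ
  /-- The coefficient of `A` on each plane. -/
  a : ι → ℝ
  /-- The eigenvalue of `S` on each remaining vector. -/
  δ : κ → ℝ
  orthonormal : Orthonormal ℝ vec
  a_ne_zero : ∀ μ, a μ ≠ 0
  a_sq : ∀ μ, a μ ^ 2 = s μ * (F - s μ)
  δ_eq : ∀ k, δ k = F ∨ δ k = 0
  S_inl : ∀ μ i, S (vec (Sum.inl (μ, i))) = s μ • vec (Sum.inl (μ, i))
  A_zero : ∀ μ, A (vec (Sum.inl (μ, 0))) = -a μ • vec (Sum.inl (μ, 1))
  A_one : ∀ μ, A (vec (Sum.inl (μ, 1))) = a μ • vec (Sum.inl (μ, 0))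
  S_inr : ∀ k, S (vec (Sum.inr k)) = δ k • vec (Sum.inr k)
  A_inr : ∀ k, A (vec (Sum.inr k)) = 0

namespace OpticalFrame

variable {S A : E →ₗ[ℝ] E} {F : ℝ} {ι κ : Type}

/-- The empty frame. -/
def empty (S A : E →ₗ[ℝ] E) (F : ℝ) : OpticalFrame S A F Empty Empty where
  vec := Sum.elim (fun x => x.1.elim) Empty.elim
  s := Empty.elim
  a := Empty.elim
  δ := Empty.elim
  orthonormal := by
    constructor
    · rintro (⟨⟨⟩, _⟩ | ⟨⟨⟩⟩)
    · rintro (⟨⟨⟩, _⟩ | ⟨⟨⟩⟩)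
  a_ne_zero := nofun
  a_sq := nofun
  δ_eq := nofun
  S_inl := nofun
  A_zero := nofun
  A_one := nofun
  S_inr := nofun
  A_inr := nofun

/-- Transport of a frame along equivalences of the index types. -/
def reindex (B : OpticalFrame S A F ι κ) {ι' κ' : Type} (f : ι' ≃ ι) (g : κ' ≃ κ) :
    OpticalFrame S A F ι' κ' where
  vec := B.vec ∘ Sum.map (Prod.map f id) g
  s := B.s ∘ f
  a := B.a ∘ f
  δ := B.δ ∘ g
  orthonormal := B.orthonormal.comp _
    (Sum.map_injective.2 ⟨f.injective.prodMap Function.injective_id, g.injective⟩)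
  a_ne_zero _ := B.a_ne_zero _
  a_sq _ := B.a_sq _
  δ_eq _ := B.δ_eq _
  S_inl _ _ := B.S_inl _ _
  A_zero _ := B.A_zero _
  A_one _ := B.A_one _
  S_inr _ := B.S_inr _
  A_inr _ := B.A_inr _

/-- Adjoin to a frame a unit vector orthogonal to it. -/
def consVec (B : OpticalFrame S A F ι κ) {v : E} {t : ℝ} (hv : ‖v‖ = 1)
    (hBv : ∀ x, ⟪B.vec x, v⟫_ℝ = 0) (ht : t = F ∨ t = 0) (hS : S v = t • v) (hA : A v = 0) :
    OpticalFrame S A F ι (Option κ) where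
  vec := Sum.elim (B.vec ∘ Sum.inl) (fun k => k.elim v (B.vec ∘ Sum.inr))
  s := B.s
  a := B.a
  δ k := k.elim t B.δ
  orthonormal := by
    have hvB : ∀ x, ⟪v, B.vec x⟫_ℝ = 0 := fun x => by rw [real_inner_comm, hBv]
    have ho := B.orthonormal
    constructor
    · rintro (x | _ | k)
      exacts [ho.1 _, hv, ho.1 _]
    · rintro (x | _ | k) (y | _ | l) hxy
      · exact ho.2 (by simpa using hxy)
      · exact hBv _
      · exact ho.2 (by simp)
      · exact hvB _
      · exact absurd rfl hxy
      · exact hvB _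
      · exact ho.2 (by simp)
      · exact hBv _
      · exact ho.2 (by simpa using hxy)
  a_ne_zero := B.a_ne_zero
  a_sq := B.a_sq
  δ_eq := by
    rintro (_ | k)
    exacts [ht, B.δ_eq k]
  S_inl := B.S_inl
  A_zero := B.A_zero
  A_one := B.A_one
  S_inr := by
    rintro (_ | k)
    exacts [hS, B.S_inr k]
  A_inr := by
    rintro (_ | k)
    exacts [hA, B.A_inr k]

/-- Adjoin to a frame an orthonormal pair orthogonal to it. -/
def consPlane (B : OpticalFrame S A F ι κ) {v w : E} {t c : ℝ} (hv : ‖v‖ = 1) (hw : ‖w‖ = 1)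
    (hvw : ⟪v, w⟫_ℝ = 0) (hBv : ∀ x, ⟪B.vec x, v⟫_ℝ = 0) (hBw : ∀ x, ⟪B.vec x, w⟫_ℝ = 0)
    (hc : c ≠ 0) (hct : c ^ 2 = t * (F - t)) (hSv : S v = t • v) (hSw : S w = t • w)
    (hAv : A v = -c • w) (hAw : A w = c • v) :
    OpticalFrame S A F (Option ι) κ where
  vec := Sum.elim (fun x => x.1.elim (![v, w] x.2) fun μ => B.vec (Sum.inl (μ, x.2)))
    (B.vec ∘ Sum.inr)
  s μ := μ.elim t B.s
  a μ := μ.elim c B.a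
  δ := B.δ
  orthonormal := by
    have hpB : ∀ i x, ⟪![v, w] i, B.vec x⟫_ℝ = 0 := by
      intro i x
      rw [real_inner_comm]
      fin_cases i
      exacts [hBv x, hBw x]
    have hBp : ∀ i x, ⟪B.vec x, ![v, w] i⟫_ℝ = 0 := fun i x => by rw [real_inner_comm, hpB]
    have hp : Orthonormal ℝ ![v, w] := by
      constructor
      · intro i
        fin_cases i
        exacts [hv, hw]
      · intro i j hij
        fin_cases i <;> fin_cases j
        · exact absurd rfl hij
        · exact hvw
        · exact (real_inner_comm _ _).trans hvw
        · exact absurd rfl hij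
    have ho := B.orthonormal
    constructor
    · rintro (⟨_ | μ, i⟩ | k)
      exacts [hp.1 i, ho.1 _, ho.1 _]
    · rintro (⟨_ | μ, i⟩ | k) (⟨_ | ν, j⟩ | l) hxy
      · exact hp.2 (by simpa using hxy)
      · exact hpB _ _
      · exact hpB _ _
      · exact hBp _ _
      · exact ho.2 (by simpa using hxy)
      · exact ho.2 (by simp)
      · exact hBp _ _
      · exact ho.2 (by simp)
      · exact ho.2 (by simpa using hxy)
  a_ne_zero := by
    rintro (_ | μ)
    exacts [hc, B.a_ne_zero μ]
  a_sq := by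
    rintro (_ | μ)
    exacts [hct, B.a_sq μ]
  δ_eq := B.δ_eq
  S_inl := by
    rintro (_ | μ) i
    · fin_cases i
      exacts [hSv, hSw]
    · exact B.S_inl μ i
  A_zero := by
    rintro (_ | μ)
    exacts [hAv, B.A_zero μ]
  A_one := by
    rintro (_ | μ)
    exacts [hAw, B.A_one μ]
  S_inr := B.S_inr
  A_inr := B.A_inr

theorem map_S_mem_span (B : OpticalFrame S A F ι κ) (x) :
    S (B.vec x) ∈ Submodule.span ℝ (Set.range B.vec) := by
  have hmem (y) : B.vec y ∈ Submodule.span ℝ (Set.range B.vec) :=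
    Submodule.subset_span ⟨y, rfl⟩
  rcases x with ⟨μ, i⟩ | k
  · exact B.S_inl μ i ▸ Submodule.smul_mem _ _ (hmem _)
  · exact B.S_inr k ▸ Submodule.smul_mem _ _ (hmem _)

theorem map_A_mem_span (B : OpticalFrame S A F ι κ) (x) :
    A (B.vec x) ∈ Submodule.span ℝ (Set.range B.vec) := by
  have hmem (y) : B.vec y ∈ Submodule.span ℝ (Set.range B.vec) :=
    Submodule.subset_span ⟨y, rfl⟩
  rcases x with ⟨μ, i⟩ | k
  · fin_cases i
    · exact B.A_zero μ ▸ Submodule.smul_mem _ _ (hmem _)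
    · exact B.A_one μ ▸ Submodule.smul_mem _ _ (hmem _)
  · exact B.A_inr k ▸ Submodule.zero_mem _

theorem mem_span_orthogonal_iff (B : OpticalFrame S A F ι κ) {v : E} :
    v ∈ (Submodule.span ℝ (Set.range B.vec))ᗮ ↔ ∀ x, ⟪B.vec x, v⟫_ℝ = 0 := by
  refine ⟨fun h x => h _ (Submodule.subset_span ⟨x, rfl⟩), fun h u hu => ?_⟩
  induction hu using Submodule.span_induction with
  | mem u hu => obtain ⟨x, rfl⟩ := hu; exact h x
  | zero => simp
  | add u u' _ _ h₁ h₂ => rw [inner_add_left, h₁, h₂, add_zero]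
  | smul c u _ h₁ => rw [real_inner_smul_left, h₁, mul_zero]

/-- A frame which does not span can be enlarged. -/
theorem exists_extension [FiniteDimensional ℝ E] [Fintype ι] [Fintype κ]
    (B : OpticalFrame S A F ι κ) (hS : S.IsSymmetric) (hA : ∀ x y, ⟪A x, y⟫_ℝ = -⟪x, A y⟫_ℝ)
    (hSA : ∀ x, S (A x) = A (S x)) (hAA : ∀ x, A (A x) = S (S x) - F • S x)
    (hcard : 2 * Fintype.card ι + Fintype.card κ < Module.finrank ℝ E) :
    Nonempty (OpticalFrame S A F ι (Option κ)) ∨ Nonempty (OpticalFrame S A F (Option ι) κ) := by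
  set W := (Submodule.span ℝ (Set.range B.vec))ᗮ with hW
  have hSW : ∀ v ∈ W, S v ∈ W := fun v hv => B.mem_span_orthogonal_iff.2 fun x => by
    rw [← hS]
    exact hv _ (B.map_S_mem_span x)
  have hAW : ∀ v ∈ W, A v ∈ W := fun v hv => B.mem_span_orthogonal_iff.2 fun x => by
    rw [← neg_eq_zero, ← hA]
    exact hv _ (B.map_A_mem_span x)
  have : Nontrivial W := by
    rw [Submodule.nontrivial_iff_ne_bot, hW, Ne, Submodule.orthogonal_eq_bot_iff]
    intro htop
    have h₁ := finrank_span_eq_card B.orthonormal.linearIndependent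
    rw [htop, finrank_top] at h₁
    simp at h₁
    omega
  obtain ⟨v, t, hvW, hv, hSv⟩ : ∃ v, ∃ t : ℝ, v ∈ W ∧ ‖v‖ = 1 ∧ S v = t • v := by
    have hsym := hS.restrict_invariant hSW
    obtain ⟨t, ht⟩ : ∃ t : ℝ, Module.End.HasEigenvalue (S.restrict hSW) t :=
      ⟨_, hsym.hasEigenvalue_iSup_of_finiteDimensional⟩
    obtain ⟨x, hx⟩ := ht.exists_hasEigenvector
    have hx₁ := congrArg Subtype.val hx.apply_eq_smul
    have hx₀ : (x : E) ≠ 0 := fun h₀ => hx.2 (Subtype.ext h₀)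
    refine ⟨(‖(x : E)‖)⁻¹ • (x : E), t, W.smul_mem _ x.2, norm_smul_inv_norm hx₀, ?_⟩
    rw [map_smul, smul_comm]
    exact congrArg _ hx₁
  have hAAv : A (A v) = -(t * (F - t)) • v := by
    rw [hAA, hSv, map_smul, hSv, smul_smul, smul_smul, ← sub_smul]
    ring_nf
  have hvB := B.mem_span_orthogonal_iff.1 hvW
  by_cases hw : A v = 0
  · refine Or.inl ⟨B.consVec hv hvB ?_ hSv hw⟩
    rw [hw, map_zero] at hAAv
    have hv₀ : v ≠ 0 := norm_ne_zero_iff.1 (by rw [hv]; exact one_ne_zero)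
    rcases mul_eq_zero.1 (neg_eq_zero.1 ((smul_eq_zero.1 hAAv.symm).resolve_right hv₀)) with h | h
    exacts [Or.inr h, Or.inl (sub_eq_zero.1 h).symm]
  · have hn : ‖A v‖ ≠ 0 := norm_ne_zero_iff.2 hw
    have hsq : ‖A v‖ ^ 2 = t * (F - t) := by
      rw [← real_inner_self_eq_norm_sq, hA, hAAv, real_inner_smul_right,
        real_inner_self_eq_norm_sq, hv]
      ring
    have hperp : ⟪v, A v⟫_ℝ = 0 := by
      have := hA v v
      rw [real_inner_comm] at this
      linarith
    refine Or.inr ⟨B.consPlane (w := -(‖A v‖)⁻¹ • A v) (c := ‖A v‖) hv ?_ ?_ hvB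
      (B.mem_span_orthogonal_iff.1 (W.smul_mem _ (hAW v hvW))) hn hsq hSv ?_ ?_ ?_⟩
    · rw [norm_smul, norm_neg, norm_inv, norm_norm, inv_mul_cancel₀ hn]
    · rw [real_inner_smul_right, hperp, mul_zero]
    · rw [map_smul, hSA, hSv, map_smul, smul_comm]
    · rw [smul_smul, neg_mul_neg, mul_inv_cancel₀ hn, one_smul]
    · rw [map_smul, hAAv, ← hsq, smul_smul]
      congr 1
      field_simp

/-- There is a frame which is a basis. -/
theorem exists_card_eq_finrank [FiniteDimensional ℝ E] (hS : S.IsSymmetric)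
    (hA : ∀ x y, ⟪A x, y⟫_ℝ = -⟪x, A y⟫_ℝ) (hSA : ∀ x, S (A x) = A (S x))
    (hAA : ∀ x, A (A x) = S (S x) - F • S x) :
    ∃ p q : ℕ, 2 * p + q = Module.finrank ℝ E ∧
      Nonempty (OpticalFrame S A F (Fin p) (Fin q)) := by
  let P (n : ℕ) : Prop := ∃ p q : ℕ, 2 * p + q = n ∧
    Nonempty (OpticalFrame S A F (Fin p) (Fin q))
  have hle (n : ℕ) (hn : P n) : n ≤ Module.finrank ℝ E := by
    obtain ⟨p, q, rfl, ⟨B⟩⟩ := hn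
    have := B.orthonormal.linearIndependent.fintype_card_le_finrank
    simp at this
    omega
  have h₀ : P 0 := ⟨0, 0, rfl, ⟨(empty S A F).reindex (Equiv.equivOfIsEmpty _ _)
    (Equiv.equivOfIsEmpty _ _)⟩⟩
  classical
  obtain ⟨p, q, hpq, ⟨B⟩⟩ := Nat.findGreatest_spec (P := P) (Nat.zero_le (Module.finrank ℝ E)) h₀
  by_contra! hne
  have hlt : 2 * p + q < Module.finrank ℝ E :=
    (hle _ ⟨p, q, rfl, ⟨B⟩⟩).lt_of_ne fun h => (hne p q h).false B
  have hmax (n : ℕ) (hn : P n) : n ≤ 2 * p + q :=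
    hpq ▸ Nat.le_findGreatest (hle n hn) hn
  rcases B.exists_extension hS hA hSA hAA (by simpa using hlt) with ⟨⟨B'⟩⟩ | ⟨⟨B'⟩⟩
  · have := hmax _ ⟨p, q + 1, rfl, ⟨B'.reindex (Equiv.refl _) (finSuccEquiv q)⟩⟩
    omega
  · have := hmax _ ⟨p + 1, q, rfl, ⟨B'.reindex (finSuccEquiv p) (Equiv.refl _)⟩⟩
    omega

end OpticalFrame

end Frame

/-- The optical constraint is symmetric under transposition: if `F ≠ 0`, it says that
`1 - (2 / F) • L` is orthogonal. -/
theorem opticalConstraint_transpose {n : Type*} [Fintype n] [DecidableEq n] {L : Matrix n n ℝ}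
    {F : ℝ} (h : L * Lᵀ = F • ((1 / 2 : ℝ) • (L + Lᵀ))) :
    Lᵀ * L = F • ((1 / 2 : ℝ) • (L + Lᵀ)) := by
  rcases eq_or_ne F 0 with rfl | hF
  · rw [zero_smul, ← conjTranspose_eq_transpose_of_trivial,
      self_mul_conjTranspose_eq_zero] at h
    simp [h]
  · have h₁ : (1 - (2 / F) • L) * (1 - (2 / F) • Lᵀ) = 1 := by
      have : (1 - (2 / F) • L) * (1 - (2 / F) • Lᵀ)
          = 1 - (2 / F) • (L + Lᵀ) + (2 / F * (2 / F)) • (L * Lᵀ) := by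
        simp only [sub_mul, mul_sub, one_mul, mul_one, smul_mul_smul_comm, smul_add]
        abel
      rw [this, h, smul_smul, smul_smul, show 2 / F * (2 / F) * F * (1 / 2) = 2 / F by field_simp]
      abel
    rw [mul_eq_one_comm] at h₁
    have h₂ : (1 - (2 / F) • Lᵀ) * (1 - (2 / F) • L)
        = 1 - (2 / F) • (L + Lᵀ) + (2 / F * (2 / F)) • (Lᵀ * L) := by
      simp only [sub_mul, mul_sub, one_mul, mul_one, smul_mul_smul_comm, smul_add]
      abel
    rw [h₂] at h₁
    have h₃ : (2 / F * (2 / F)) • (Lᵀ * L) = (2 / F) • (L + Lᵀ) := by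
      rw [← sub_eq_zero]
      rw [← sub_eq_zero] at h₁
      rw [← h₁]
      abel
    have h₄ := congrArg (fun M => (F / 2 * (F / 2)) • M) h₃
    simp only [smul_smul] at h₄
    rw [show F / 2 * (F / 2) * (2 / F * (2 / F)) = 1 by field_simp, one_smul] at h₄
    rw [h₄, smul_smul]
    congr 1
    field_simp

/-- Conjugating `M` by the matrix whose columns are the vectors `b x` gives the inner products of
`b x` with the image of `b y` under `M`. -/
theorem transpose_mul_mul_apply_of_columns {d : ℕ} {m : Type*} (b : m → EuclideanSpace ℝ (Fin d))
    (M : Matrix (Fin d) (Fin d) ℝ) (x y : m) :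
    ((of fun i x => b x i)ᵀ * M * (of fun i x => b x i)) x y = ⟪b x, toEuclideanLin M (b y)⟫_ℝ := by
  rw [Matrix.mul_assoc]
  simp [Matrix.mul_apply, PiLp.inner_apply, mulVec, dotProduct, mul_comm, Matrix.toLpLin_apply]

/-- Canonical block form of a real matrix `L` satisfying the optical constraint
`L Lᵀ = F S` with `S = (1/2)(L + Lᵀ)`: there is an orthogonal change of basis `Q`
after which `L` is block diagonal, with `p` twisting 2×2 blocks
`[[s_μ, a_μ], [−a_μ, s_μ]]` (where `a_μ ≠ 0` and `a_μ² = s_μ(F − s_μ)`) and a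
remaining diagonal block whose entries are each `F` or `0`. -/
theorem opticalConstraint_block_form {d : ℕ} (L : Matrix (Fin d) (Fin d) ℝ) (F : ℝ)
    (h : L * Lᵀ = F • ((1 / 2 : ℝ) • (L + Lᵀ))) :
    ∃ (p : ℕ) (_ : 2 * p ≤ d) (Q : Matrix (Fin d) (Fin d) ℝ)
      (e : ((Fin p × Fin 2) ⊕ Fin (d - 2 * p)) ≃ Fin d)
      (s a : Fin p → ℝ) (δ : Fin (d - 2 * p) → ℝ),
      Qᵀ * Q = 1 ∧
      (∀ μ, a μ ≠ 0 ∧ a μ ^ 2 = s μ * (F - s μ)) ∧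
      (∀ i, δ i = F ∨ δ i = 0) ∧
      (∀ x y : (Fin p × Fin 2) ⊕ Fin (d - 2 * p),
        (Qᵀ * L * Q) (e x) (e y) =
          match x, y with
          | Sum.inl (μ, i), Sum.inl (ν, j) =>
              if μ = ν then
                (if i = j then s μ else if i = 0 then a μ else -(a μ))
              else 0
          | Sum.inr i, Sum.inr j => if i = j then δ i else 0
          | _, _ => 0) := by
  have h' := opticalConstraint_transpose h
  set S : Matrix (Fin d) (Fin d) ℝ := (1 / 2 : ℝ) • (L + Lᵀ) with hSdef
  set A : Matrix (Fin d) (Fin d) ℝ := (1 / 2 : ℝ) • (L - Lᵀ) with hAdef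
  have hL : L = S + A := by
    rw [hSdef, hAdef]
    module
  have hSA : S * A = A * S := by
    rw [hSdef, hAdef]
    simp only [smul_mul_smul_comm, add_mul, mul_add, sub_mul, mul_sub, h, h']
    module
  have hAA : A * A = S * S - F • S := by
    have : S * S - A * A = (1 / 2 : ℝ) • (L * Lᵀ + Lᵀ * L) := by
      rw [hSdef, hAdef]
      simp only [smul_mul_smul_comm, add_mul, mul_add, sub_mul, mul_sub]
      module
    rw [h, h'] at this
    rw [eq_sub_iff_add_eq, sub_eq_iff_eq_add.1 this]
    module
  have hSt : Sᵀ = S := by simp [hSdef, add_comm]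
  have hAt : Aᵀ = -A := by
    rw [hAdef, transpose_smul, transpose_sub, transpose_transpose]
    module
  have hadj (M : Matrix (Fin d) (Fin d) ℝ) (x y : EuclideanSpace ℝ (Fin d)) :
      ⟪toEuclideanLin M x, y⟫_ℝ = ⟪x, toEuclideanLin Mᵀ y⟫_ℝ := by
    rw [← conjTranspose_eq_transpose_of_trivial, toEuclideanLin_conjTranspose_eq_adjoint,
      LinearMap.adjoint_inner_right]
  have hmul (M N : Matrix (Fin d) (Fin d) ℝ) (x : EuclideanSpace ℝ (Fin d)) :
      toEuclideanLin M (toEuclideanLin N x) = toEuclideanLin (M * N) x := by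
    simp [Matrix.toLpLin_apply]
  obtain ⟨p, q, hpq, ⟨B⟩⟩ := OpticalFrame.exists_card_eq_finrank (S := toEuclideanLin S)
    (A := toEuclideanLin A) (F := F) (fun x y => by rw [hadj, hSt])
    (fun x y => by rw [hadj, hAt, map_neg, LinearMap.neg_apply, inner_neg_right])
    (fun x => by rw [hmul, hmul, hSA])
    (fun x => by rw [hmul, hmul, hAA, map_sub, map_smul, LinearMap.sub_apply, LinearMap.smul_apply])
  rw [finrank_euclideanSpace_fin] at hpq
  obtain rfl : q = d - 2 * p := by omega
  let e : ((Fin p × Fin 2) ⊕ Fin (d - 2 * p)) ≃ Fin d :=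
    Fintype.equivFinOfCardEq (by simp; omega)
  have hon := B.orthonormal.comp _ e.symm.injective
  refine ⟨p, by omega, of fun i x => (B.vec ∘ e.symm) x i, e, B.s, B.a, B.δ, ?_,
    fun μ => ⟨B.a_ne_zero μ, B.a_sq μ⟩, B.δ_eq, ?_⟩
  · ext x y
    have := transpose_mul_mul_apply_of_columns (B.vec ∘ e.symm) 1 x y
    rw [Matrix.mul_one] at this
    rw [this, Matrix.one_apply, ← orthonormal_iff_ite.1 hon x y]
    simp
  · intro x y
    have hB := orthonormal_iff_ite.1 B.orthonormal
    rw [transpose_mul_mul_apply_of_columns]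
    simp only [Function.comp_apply, Equiv.symm_apply_apply]
    rw [hL, map_add, LinearMap.add_apply, inner_add_right]
    rcases y with ⟨ν, j⟩ | l
    · rw [B.S_inl, real_inner_smul_right, hB]
      fin_cases j
      · simp only [Fin.zero_eta]
        rw [B.A_zero, real_inner_smul_right, hB]
        rcases x with ⟨μ, i⟩ | k
        · fin_cases i <;> by_cases hμ : μ = ν <;> simp [hμ]
        · simp
      · simp only [Fin.mk_one]
        rw [B.A_one, real_inner_smul_right, hB]
        rcases x with ⟨μ, i⟩ | k
        · fin_cases i <;> by_cases hμ : μ = ν <;> simp [hμ]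
        · simp
    · rw [B.S_inr, B.A_inr, inner_zero_right, add_zero, real_inner_smul_right, hB]
      rcases x with ⟨μ, i⟩ | k
      · simp
      · by_cases hk : k = l <;> simp [hk]
end

section
/- Let I ⊆ ℝ be an open interval, r₀ ∈ I, and let L : ℝ → Matrix (Fin d) (Fin d) ℝ satisfy the Sachs equation, i.e. L has derivative −L(r)·L(r) at every r ∈ I, with L(r) invertible for every r ∈ I. Then for every r ∈ I, L(r)⁻¹ = L(r₀)⁻¹ + (r − r₀)·1; that is, the inverse of the optical matrix is an affine function of the affine parameter. -/
open Matrix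

/-- The inverse of an invertible solution of the Riccati equation `L' = -L * L` in a Banach algebra
is an affine function. -/
theorem ringInverse_eq_add_smul_of_hasDerivAt_neg_mul_self {R : Type*} [NormedRing R]
    [NormedAlgebra ℝ R] [HasSummableGeomSeries R] {I : Set ℝ} (hI : IsOpen I)
    (hI' : IsPreconnected I) {L : ℝ → R} (hderiv : ∀ r ∈ I, HasDerivAt L (-(L r * L r)) r)
    (hunit : ∀ r ∈ I, IsUnit (L r)) {r₀ r : ℝ} (hr₀ : r₀ ∈ I) (hr : r ∈ I) :
    Ring.inverse (L r) = Ring.inverse (L r₀) + (r - r₀) • (1 : R) := by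
  have key : ∀ t ∈ I, HasDerivAt (fun t => Ring.inverse (L t) - t • (1 : R)) 0 t := by
    intro t ht
    obtain ⟨u, hu⟩ := hunit t ht
    have hinv := hasFDerivAt_ringInverse (𝕜 := ℝ) u
    rw [hu] at hinv
    have h := (hinv.comp_hasDerivAt t (hderiv t ht)).sub
      ((hasDerivAt_id t).smul_const (1 : R))
    refine h.congr_deriv ?_
    simp [← hu, ← mul_assoc]
  have hconst := hI.is_const_of_deriv_eq_zero hI'
    (fun t ht => (key t ht).differentiableAt.differentiableWithinAt)
    (fun t ht => (key t ht).deriv) hr hr₀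
  rw [sub_eq_iff_eq_add] at hconst
  rw [hconst, sub_smul]
  abel

/-- If the optical matrix `L(r)` satisfies the Sachs equation `L' = −L·L`
(entrywise) on an open interval `I` and is invertible there, then its inverse is
an affine function of the affine parameter:
`L(r)⁻¹ = L(r₀)⁻¹ + (r − r₀)·1` for all `r ∈ I`. -/
theorem sachs_inverse_affine {d : ℕ} (I : Set ℝ) (hI : IsOpen I) (hI' : I.OrdConnected)
    (r₀ : ℝ) (hr₀ : r₀ ∈ I) (L : ℝ → Matrix (Fin d) (Fin d) ℝ)
    (hderiv : ∀ r ∈ I, ∀ i j, HasDerivAt (fun t => L t i j) ((-(L r * L r)) i j) r)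
    (hinv : ∀ r ∈ I, IsUnit (L r).det) :
    ∀ r ∈ I, (L r)⁻¹ = (L r₀)⁻¹ + (r - r₀) • (1 : Matrix (Fin d) (Fin d) ℝ) := by
  intro r hr
  rw [nonsing_inv_eq_ringInverse, nonsing_inv_eq_ringInverse]
  open scoped Matrix.Norms.Operator in
  refine ringInverse_eq_add_smul_of_hasDerivAt_neg_mul_self hI hI'.isPreconnected
    (fun t ht => ?_) (fun t ht => (isUnit_iff_isUnit_det _).2 (hinv t ht)) hr₀ hr
  exact hasDerivAt_pi.2 fun i => hasDerivAt_pi.2 fun j => hderiv t ht i j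
end

section
/- Let d ≥ 1, let I ⊆ ℝ be an open interval, r₀ ∈ I, and let L : ℝ → Matrix (Fin d) (Fin d) ℝ satisfy the Sachs equation (derivative −L(r)·L(r)) at every r ∈ I, with L(r) invertible for every r ∈ I. Write S(r) := (1/2)(L(r) + L(r)ᵀ). If the optical constraint L(r₀) L(r₀)ᵀ = F₀ S(r₀) holds at r₀ for some F₀ ∈ ℝ, then for every r ∈ I with 1 + (r − r₀)F₀ ≠ 0 the optical constraint holds at r with the evolved parameter: L(r) L(r)ᵀ = (F₀ / (1 + (r − r₀)F₀)) S(r). -/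
open Matrix

/-- A solution of `u' = -u * u` with invertible values has an affine inverse. -/
lemma inverse_eq_add_of_hasDerivAt_neg_mul_self {R : Type*} [NormedRing R] [NormedAlgebra ℝ R]
    [CompleteSpace R] {I : Set ℝ} (hI : IsOpen I) (hI' : I.OrdConnected) {u : ℝ → R}
    (hu : ∀ r ∈ I, HasDerivAt u (-(u r * u r)) r) (hunit : ∀ r ∈ I, IsUnit (u r))
    {r₀ r : ℝ} (hr₀ : r₀ ∈ I) (hr : r ∈ I) :
    Ring.inverse (u r) = Ring.inverse (u r₀) + (r - r₀) • (1 : R) := by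
  have hder : ∀ t ∈ I, HasDerivAt (fun t => Ring.inverse (u t) - t • (1 : R)) 0 t := by
    intro t ht
    obtain ⟨x, hx⟩ := hunit t ht
    have h₁ : HasFDerivAt Ring.inverse
        (-ContinuousLinearMap.mulLeftRight ℝ R ↑x⁻¹ ↑x⁻¹) (u t) :=
      hx ▸ hasFDerivAt_ringInverse x
    have h₂ := (h₁.comp_hasDerivAt t (hu t ht)).sub ((hasDerivAt_id t).smul_const (1 : R))
    refine h₂.congr_deriv ?_
    simp [← hx, ← mul_assoc]
  have hconst := hI.is_const_of_deriv_eq_zero hI'.isPreconnected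
    (fun t ht => (hder t ht).differentiableAt.differentiableWithinAt)
    (fun t ht => (hder t ht).deriv) hr hr₀
  rw [sub_smul, sub_eq_iff_eq_add.mp hconst]
  abel

/-- For invertible `A`, the optical constraint is linear in `A⁻¹`. -/
lemma mul_transpose_eq_smul_iff {n : Type*} [Fintype n] [DecidableEq n] {A : Matrix n n ℝ}
    (hA : IsUnit A.det) (F : ℝ) :
    A * Aᵀ = F • ((1 / 2 : ℝ) • (A + Aᵀ)) ↔ F • ((1 / 2 : ℝ) • (A⁻¹ + A⁻¹ᵀ)) = 1 := by
  have hA' : IsUnit Aᵀ.det := by rwa [det_transpose]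
  have hsum : A * (A⁻¹ + A⁻¹ᵀ) * Aᵀ = A + Aᵀ := by
    rw [transpose_nonsing_inv, Matrix.mul_add, Matrix.add_mul, mul_nonsing_inv _ hA,
      Matrix.one_mul, Matrix.mul_assoc, nonsing_inv_mul _ hA', Matrix.mul_one, add_comm]
  have hsum' : A⁻¹ * (A + Aᵀ) * Aᵀ⁻¹ = A⁻¹ + A⁻¹ᵀ := by
    rw [transpose_nonsing_inv, Matrix.mul_add, Matrix.add_mul, nonsing_inv_mul _ hA,
      Matrix.one_mul, Matrix.mul_assoc, mul_nonsing_inv _ hA', Matrix.mul_one, add_comm]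
  constructor
  · intro h
    rw [← hsum', ← Matrix.smul_mul, ← Matrix.smul_mul, ← Matrix.mul_smul, ← Matrix.mul_smul, ← h,
      ← Matrix.mul_assoc, nonsing_inv_mul _ hA, Matrix.one_mul, mul_nonsing_inv _ hA']
  · intro h
    rw [← hsum, ← Matrix.smul_mul, ← Matrix.smul_mul, ← Matrix.mul_smul, ← Matrix.mul_smul, h,
      Matrix.mul_one]

open scoped Matrix.Norms.Operator in
/-- The inverse of an invertible matrix solution of the Sachs equation is affine. -/
lemma nonsing_inv_eq_add_of_sachs {n : Type*} [Fintype n] [DecidableEq n]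
    {I : Set ℝ} (hI : IsOpen I) (hI' : I.OrdConnected) {L : ℝ → Matrix n n ℝ}
    (hderiv : ∀ r ∈ I, ∀ i j, HasDerivAt (fun t => L t i j) ((-(L r * L r)) i j) r)
    (hinv : ∀ r ∈ I, IsUnit (L r).det) {r₀ r : ℝ} (hr₀ : r₀ ∈ I) (hr : r ∈ I) :
    (L r)⁻¹ = (L r₀)⁻¹ + (r - r₀) • (1 : Matrix n n ℝ) := by
  simp only [nonsing_inv_eq_ringInverse]
  refine inverse_eq_add_of_hasDerivAt_neg_mul_self hI hI' (fun t ht => ?_)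
    (fun t ht => (isUnit_iff_isUnit_det _).mpr (hinv t ht)) hr₀ hr
  exact hasDerivAt_pi.mpr fun i => hasDerivAt_pi.mpr fun j => hderiv t ht i j

open Matrix

/-- Propagation of the optical constraint along the Sachs equation: if `L(r)`
satisfies `L' = −L·L` (entrywise) on an open interval `I`, is invertible there,
and satisfies the optical constraint `L Lᵀ = F₀ S` at `r₀ ∈ I` (with
`S = (1/2)(L + Lᵀ)`), then at every `r ∈ I` with `1 + (r − r₀)F₀ ≠ 0` the
optical constraint holds with the evolved parameter `F₀ / (1 + (r − r₀)F₀)`. -/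
theorem sachs_opticalConstraint_propagates {d : ℕ} (hd : 1 ≤ d)
    (I : Set ℝ) (hI : IsOpen I) (hI' : I.OrdConnected)
    (r₀ : ℝ) (hr₀ : r₀ ∈ I) (L : ℝ → Matrix (Fin d) (Fin d) ℝ)
    (hderiv : ∀ r ∈ I, ∀ i j, HasDerivAt (fun t => L t i j) ((-(L r * L r)) i j) r)
    (hinv : ∀ r ∈ I, IsUnit (L r).det) (F₀ : ℝ)
    (h₀ : L r₀ * (L r₀)ᵀ = F₀ • ((1 / 2 : ℝ) • (L r₀ + (L r₀)ᵀ))) :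
    ∀ r ∈ I, 1 + (r - r₀) * F₀ ≠ 0 →
      L r * (L r)ᵀ = (F₀ / (1 + (r - r₀) * F₀)) • ((1 / 2 : ℝ) • (L r + (L r)ᵀ)) := by
  intro r hr hne
  rw [mul_transpose_eq_smul_iff (hinv r₀ hr₀)] at h₀
  rw [mul_transpose_eq_smul_iff (hinv r hr), nonsing_inv_eq_add_of_sachs hI hI' hderiv hinv hr₀ hr]
  have key : F₀ • ((1 / 2 : ℝ) • ((L r₀)⁻¹ + (r - r₀) • (1 : Matrix (Fin d) (Fin d) ℝ) +
      ((L r₀)⁻¹ + (r - r₀) • (1 : Matrix (Fin d) (Fin d) ℝ))ᵀ)) =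
      (1 + (r - r₀) * F₀) • (1 : Matrix (Fin d) (Fin d) ℝ) := by
    rw [transpose_add, transpose_smul, transpose_one]
    linear_combination (norm := module) h₀
  rw [div_eq_inv_mul, mul_smul, key, inv_smul_smul₀ hne]
end

section
/- Let I ⊆ ℝ be an open interval, r₀ ∈ I, and let L : ℝ → Matrix (Fin d) (Fin d) ℝ satisfy the Sachs equation (derivative −L(r)·L(r)) at every r ∈ I, with L(r) invertible for every r ∈ I. Let v : ℝ → ℝᵈ be a row-vector-valued function whose derivative at every r ∈ I is −v(r)·L(r) (i.e. v_i'(r) = −v_j(r) L_{ji}(r)). Then for every r ∈ I, v(r) = v(r₀)·L(r₀)⁻¹·L(r); in particular the row vector v(r)·L(r)⁻¹ is constant on I. -/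
open Matrix

section Differentiability

variable {n : Type*} [Fintype n] [DecidableEq n] {A : ℝ → Matrix n n ℝ} {x : ℝ}

lemma differentiableAt_matrix_det (hA : ∀ i j, DifferentiableAt ℝ (fun t => A t i j) x) :
    DifferentiableAt ℝ (fun t => (A t).det) x := by
  simp only [det_apply']
  refine DifferentiableAt.fun_sum fun σ _ => DifferentiableAt.const_mul ?_ _
  exact DifferentiableAt.fun_finsetProd fun i _ => hA _ _

lemma differentiableAt_matrix_inv_apply (hA : ∀ i j, DifferentiableAt ℝ (fun t => A t i j) x)
    (hx : IsUnit (A x).det) (i j : n) : DifferentiableAt ℝ (fun t => (A t)⁻¹ i j) x := by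
  simp only [inv_def, Ring.inverse_eq_inv', Matrix.smul_apply, smul_eq_mul, adjugate_apply]
  refine ((differentiableAt_matrix_det hA).inv hx.ne_zero).mul
    (differentiableAt_matrix_det fun k l => ?_)
  by_cases hk : k = j
  · subst hk
    simp only [updateRow_self]
    exact differentiableAt_const _
  · simpa only [updateRow_ne hk] using hA k l

end Differentiability

/-- If `L(r)` satisfies the Sachs equation `L' = −L·L` (entrywise) on an open
interval `I` and is invertible there, and a row vector `v(r)` satisfies
`v' = −v·L` (entrywise), then `v(r) = v(r₀)·L(r₀)⁻¹·L(r)` for all `r ∈ I`;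
in particular `v(r)·L(r)⁻¹` is constant on `I`. -/
theorem sachs_transported_row_vector {d : ℕ} (I : Set ℝ) (hI : IsOpen I)
    (hI' : I.OrdConnected) (r₀ : ℝ) (hr₀ : r₀ ∈ I)
    (L : ℝ → Matrix (Fin d) (Fin d) ℝ) (v : ℝ → Fin d → ℝ)
    (hderiv : ∀ r ∈ I, ∀ i j, HasDerivAt (fun t => L t i j) ((-(L r * L r)) i j) r)
    (hinv : ∀ r ∈ I, IsUnit (L r).det)
    (hv : ∀ r ∈ I, ∀ i, HasDerivAt (fun t => v t i) ((-(v r ᵥ* L r)) i) r) :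
    ∀ r ∈ I, v r = (v r₀ ᵥ* (L r₀)⁻¹) ᵥ* L r ∧ v r ᵥ* (L r)⁻¹ = v r₀ ᵥ* (L r₀)⁻¹ := by
  set w : ℝ → Fin d → ℝ := fun t => v t ᵥ* (L t)⁻¹ with hw
  have hwL : ∀ r ∈ I, w r ᵥ* L r = v r := fun r hr => by
    simp [hw, vecMul_vecMul, nonsing_inv_mul _ (hinv r hr)]
  have hwdiff : ∀ r ∈ I, ∀ i, DifferentiableAt ℝ (fun t => w t i) r := fun r hr i => by
    simp only [hw, vecMul, dotProduct]
    exact DifferentiableAt.fun_sum fun j _ => (hv r hr j).differentiableAt.fun_mul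
      (differentiableAt_matrix_inv_apply (fun k l => (hderiv r hr k l).differentiableAt)
        (hinv r hr) j i)
  have hwderiv : ∀ r ∈ I, (fun i => deriv (fun t => w t i) r) = 0 := fun r hr => by
    set w' : Fin d → ℝ := fun i => deriv (fun t => w t i) r
    have key : w' ᵥ* L r = 0 := by
      ext j
      have hprod : HasDerivAt (fun t => (w t ᵥ* L t) j)
          (∑ i, (w' i * L r i j + w r i * (-(L r * L r)) i j)) r := by
        simp only [vecMul, dotProduct]
        exact HasDerivAt.fun_sum fun i _ => (hwdiff r hr i).hasDerivAt.fun_mul (hderiv r hr i j)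
      have hvj : HasDerivAt (fun t => (w t ᵥ* L t) j) ((-(v r ᵥ* L r)) j) r :=
        (hv r hr j).congr_of_eventuallyEq <| by
          filter_upwards [hI.mem_nhds hr] with t ht
          rw [hwL t ht]
      have heq : (w' ᵥ* L r) j + (w r ᵥ* (-(L r * L r))) j = (-(v r ᵥ* L r)) j := by
        rw [← hprod.unique hvj, Finset.sum_add_distrib]
        rfl
      rw [vecMul_neg, ← vecMul_vecMul, hwL r hr] at heq
      simpa using heq
    have := congrArg (· ᵥ* (L r)⁻¹) key
    simpa [vecMul_vecMul, mul_nonsing_inv _ (hinv r hr)] using this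
  have hconst : ∀ r ∈ I, w r = w r₀ := fun r hr => by
    ext i
    exact hI.is_const_of_deriv_eq_zero hI'.isPreconnected
      (fun t ht => (hwdiff t ht i).differentiableWithinAt)
      (fun t ht => congrFun (hwderiv t ht) i) hr hr₀
  exact fun r hr => ⟨by rw [← hwL r hr, hconst r hr], hconst r hr⟩
end

section
/- Let d be odd and let L be a real d×d matrix satisfying the optical constraint L Lᵀ = F S for some F ∈ ℝ, where S = (1/2)(L + Lᵀ), and suppose S = θ·1 for some θ ∈ ℝ (shearfree case). Then L is symmetric, i.e. its antisymmetric part vanishes, and in fact L = θ·1; thus in odd dimensions a shearfree congruence obeying the optical constraint is necessarily twistfree. -/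
open Matrix

/-- An antisymmetric real matrix of odd size has vanishing determinant. -/
theorem Matrix.det_eq_zero_of_transpose_eq_neg {d : ℕ} (hd : Odd d)
    {A : Matrix (Fin d) (Fin d) ℝ} (hA : Aᵀ = -A) : A.det = 0 := by
  have h : A.det = -A.det := by
    conv_lhs => rw [← det_transpose, hA, det_neg, Fintype.card_fin, hd.neg_one_pow, neg_one_mul]
  linarith

/-- An antisymmetric real matrix of odd size with `A Aᵀ` a multiple of the identity vanishes. -/
theorem Matrix.eq_zero_of_transpose_eq_neg_of_mul_transpose_eq_smul_one {d : ℕ} (hd : Odd d)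
    {A : Matrix (Fin d) (Fin d) ℝ} (hA : Aᵀ = -A) {c : ℝ} (h : A * Aᵀ = c • 1) : A = 0 := by
  have hc : c = 0 := by
    have hdet := congrArg det h
    rw [det_mul, det_eq_zero_of_transpose_eq_neg hd hA, zero_mul, det_smul, det_one, mul_one]
      at hdet
    exact eq_zero_of_pow_eq_zero hdet.symm
  rw [hc, zero_smul, ← conjTranspose_eq_transpose_of_trivial] at h
  exact self_mul_conjTranspose_eq_zero.mp h

/-- In odd dimension `d`, a shearfree matrix obeying the optical constraint is
necessarily twistfree: if `d` is odd, `L Lᵀ = F S`, and `S = (1/2)(L + Lᵀ) = θ·1`,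
then `L` is symmetric and in fact `L = θ·1`. -/
theorem opticalConstraint_shearfree_odd_twistfree {d : ℕ} (hd : Odd d)
    (L : Matrix (Fin d) (Fin d) ℝ) (F θ : ℝ)
    (h : L * Lᵀ = F • ((1 / 2 : ℝ) • (L + Lᵀ)))
    (hshear : (1 / 2 : ℝ) • (L + Lᵀ) = θ • (1 : Matrix (Fin d) (Fin d) ℝ)) :
    Lᵀ = L ∧ L = θ • (1 : Matrix (Fin d) (Fin d) ℝ) := by
  have hsum : L + Lᵀ = (2 * θ) • (1 : Matrix (Fin d) (Fin d) ℝ) := by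
    rw [mul_smul, ← hshear, smul_smul]
    norm_num
  have hA : (L - θ • (1 : Matrix (Fin d) (Fin d) ℝ))ᵀ = -(L - θ • 1) := by
    rw [transpose_sub, transpose_smul, transpose_one, eq_sub_of_add_eq' hsum]
    module
  have hmul : (L - θ • (1 : Matrix (Fin d) (Fin d) ℝ)) * (L - θ • 1)ᵀ = (F * θ - θ ^ 2) • 1 := by
    have hexp : (L - θ • (1 : Matrix (Fin d) (Fin d) ℝ)) * (L - θ • 1)ᵀ
        = L * Lᵀ - θ • (L + Lᵀ) + θ ^ 2 • 1 := by
      simp only [transpose_sub, transpose_smul, transpose_one, sub_mul, mul_sub, smul_mul_assoc,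
        mul_smul_comm, one_mul, mul_one]
      module
    rw [hexp, h, hshear, hsum]
    module
  have hL : L = θ • (1 : Matrix (Fin d) (Fin d) ℝ) :=
    sub_eq_zero.mp (eq_zero_of_transpose_eq_neg_of_mul_transpose_eq_smul_one hd hA hmul)
  refine ⟨?_, hL⟩
  rw [hL, transpose_smul, transpose_one]
end
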